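/- The outer perimeter is a homotopy-type invariant of digital pictures: if {i,j} = {1,2} and the digital pictures (X,c_i,c_j) and (Y,c_i,c_j) are homotopy equivalent, then O(X,c_i,c_j) = O(Y,c_i,c_j). -/

import Mathlib

/-- Points of the digital plane. -/
abbrev Pt : Type := ℤ × ℤ

/-- `c_i`-adjacency on `ℤ²` (for `i = 1` or `i = 2`). -/
def cAdj (i : ℕ) (x y : Pt) : Prop :=
  if i = 1 then |x.1 - y.1| + |x.2 - y.2| ≤ 1
  else |x.1 - y.1| ≤ 1 ∧ |x.2 - y.2| ≤ 1

/-- The adjacency induced on a subset of `ℤ²`. -/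
def subAdj (i : ℕ) (X : Set Pt) (x y : X) : Prop := cAdj i x.1 y.1

/-- Digital continuity of a map between digital images. -/
def DigCont {α β : Type} (κ : α → α → Prop) (δ : β → β → Prop) (f : α → β) : Prop :=
  ∀ x y, κ x y → δ (f x) (f y)

/-- The standard (`c_1`) adjacency on `ℕ`, used for digital intervals. -/
def natAdj (s t : ℕ) : Prop := s = t ∨ s + 1 = t ∨ t + 1 = s

/-- The two normal product adjacencies on `α × ℕ`. -/
def prodAdj (i : ℕ) {α : Type} (κ : α → α → Prop) (p q : α × ℕ) : Prop :=
  if i = 1 then (κ p.1 q.1 ∧ p.2 = q.2) ∨ (p.1 = q.1 ∧ natAdj p.2 q.2)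
  else κ p.1 q.1 ∧ natAdj p.2 q.2

/-- `f` and `g` are `i`-homotopic: there is a continuous
`H : X ×_i [0,m]_ℤ → Y` with `H(·,0) = f` and `H(·,m) = g`. -/
def Homotopic (i : ℕ) {α β : Type} (κ : α → α → Prop) (δ : β → β → Prop)
    (f g : α → β) : Prop :=
  ∃ (m : ℕ) (H : α → ℕ → β),
    (∀ x, H x 0 = f x) ∧ (∀ x, H x m = g x) ∧
    (∀ x y s t, s ≤ m → t ≤ m → prodAdj i κ (x, s) (y, t) → δ (H x s) (H y t))

/-- `i`-homotopy equivalence of digital images. -/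
def HtpyEquiv (i : ℕ) {α β : Type} (κ : α → α → Prop) (δ : β → β → Prop) : Prop :=
  ∃ (f : α → β) (g : β → α),
    DigCont κ δ f ∧ DigCont δ κ g ∧
    Homotopic i κ κ (g ∘ f) id ∧ Homotopic i δ δ (f ∘ g) id

/-- Homotopy equivalence of digital pictures `(X, c_i, c_j)` and `(Y, c_i, c_j)`. -/
def PicHtpyEquiv (i j : ℕ) (X Y : Set Pt) : Prop :=
  HtpyEquiv i (subAdj i X) (subAdj i Y) ∧ HtpyEquiv j (subAdj j Xᶜ) (subAdj j Yᶜ)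

/-- Isomorphism of digital images: a continuous bijection with continuous inverse. -/
def DigIso {α β : Type} (κ : α → α → Prop) (δ : β → β → Prop) : Prop :=
  ∃ e : α ≃ β, DigCont κ δ ⇑e ∧ DigCont δ κ ⇑e.symm

/-- Isomorphism of digital pictures. -/
def PicIso (i j : ℕ) (X Y : Set Pt) : Prop :=
  DigIso (subAdj i X) (subAdj i Y) ∧ DigIso (subAdj j Xᶜ) (subAdj j Yᶜ)

/-- `x` and `y` are joined by a `c_i`-path inside `A`. -/
def ChainIn (i : ℕ) (A : Set Pt) (x y : Pt) : Prop :=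
  ∃ (n : ℕ) (c : ℕ → Pt), c 0 = x ∧ c n = y ∧ (∀ k ≤ n, c k ∈ A) ∧
    ∀ k < n, cAdj i (c k) (c (k + 1))

/-- `A` is `c_i`-connected. -/
def Conn (i : ℕ) (A : Set Pt) : Prop := ∀ x ∈ A, ∀ y ∈ A, ChainIn i A x y

/-- The `c_i`-component of `p` in `A`. -/
def compOf (i : ℕ) (A : Set Pt) (p : Pt) : Set Pt := {y | ChainIn i A p y}

/-- The digital picture `(X, c_i, c_j)` has no hole: every `c_j`-component
of the complement of `X` is infinite. -/
def NoHole (j : ℕ) (X : Set Pt) : Prop := ∀ p ∈ Xᶜ, (compOf j Xᶜ p).Infinite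

/-- The row of `X` at height `k`. -/
def rowOf (X : Set Pt) (k : ℤ) : Set Pt := X ∩ {p | p.2 = k}

/-- `r` is a row component of `(X, c_i)`: a `c_i`-component of a row of `X`. -/
def IsRowComp (i : ℕ) (X : Set Pt) (r : Set Pt) : Prop :=
  ∃ (k : ℤ) (p : Pt), p ∈ rowOf X k ∧ r = compOf i (rowOf X k) p

/-- Two subsets of `ℤ²` are `c_i`-adjacent. -/
def setAdj (i : ℕ) (A B : Set Pt) : Prop := ∃ a ∈ A, ∃ b ∈ B, cAdj i a b

/-- The edge relation of the row component graph `R(X, c_i)`: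
two distinct row components joined when they are `c_i`-adjacent. -/
def rcgAdj (i : ℕ) (X : Set Pt) (r s : Set Pt) : Prop :=
  IsRowComp i X r ∧ IsRowComp i X s ∧ r ≠ s ∧ setAdj i r s

/-- The row component graph `R(X, c_i)` is acyclic: there is no cycle of
`k ≥ 3` distinct row components with consecutive ones adjacent. -/
def RCGAcyclic (i : ℕ) (X : Set Pt) : Prop :=
  ¬ ∃ (k : ℕ) (r : ℕ → Set Pt), 3 ≤ k ∧
    (∀ t < k, IsRowComp i X (r t)) ∧
    (∀ t < k, ∀ t' < k, r t = r t' → t = t') ∧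
    (∀ t, t + 1 < k → rcgAdj i X (r t) (r (t + 1))) ∧
    rcgAdj i X (r (k - 1)) (r 0)

/-- The row component graph `R(X, c_i)` is connected. -/
def RCGConnected (i : ℕ) (X : Set Pt) : Prop :=
  ∀ r s : Set Pt, IsRowComp i X r → IsRowComp i X s →
    Relation.ReflTransGen (rcgAdj i X) r s

/-- A digital image is `i`-contractible: the identity is `i`-homotopic to a constant map. -/
def Contractible (i : ℕ) {α : Type} (κ : α → α → Prop) : Prop :=
  ∃ x₀ : α, Homotopic i κ κ id (fun _ => x₀)

/-- Row-convexity. -/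
def RowConvex (X : Set Pt) : Prop :=
  ∀ a b c k : ℤ, (a, k) ∈ X → (c, k) ∈ X → a ≤ b → b ≤ c → (b, k) ∈ X

/-- Column-convexity. -/
def ColConvex (X : Set Pt) : Prop :=
  ∀ a b c k : ℤ, (k, a) ∈ X → (k, c) ∈ X → a ≤ b → b ≤ c → (k, b) ∈ X

/-- The row-convex hull of `X`. -/
def Hr (X : Set Pt) : Set Pt := ⋂₀ {S | RowConvex S ∧ X ⊆ S}

/-- The column-convex hull of `X`. -/
def Hc (X : Set Pt) : Set Pt := ⋂₀ {S | ColConvex S ∧ X ⊆ S}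

/-- The rc-convex hull of `X`. -/
def Hrc (X : Set Pt) : Set Pt := ⋂₀ {S | (RowConvex S ∧ ColConvex S) ∧ X ⊆ S}

/-- A loop of length `m` inside `Z`: a continuous `γ : [0,m]_ℤ → Z` with `γ 0 = γ m`. -/
def LoopIn (j : ℕ) (Z : Set Pt) (m : ℕ) (γ : ℕ → Pt) : Prop :=
  γ 0 = γ m ∧ (∀ t ≤ m, γ t ∈ Z) ∧ ∀ t < m, cAdj j (γ t) (γ (t + 1))

/-- The loop `γ` is `j`-contractible in `Z`: there is a `j`-homotopy in `Z` from `γ`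
to the constant loop at `γ 0` whose every stage is a loop based at `γ 0`. -/
def LoopContractibleIn (j : ℕ) (Z : Set Pt) (m : ℕ) (γ : ℕ → Pt) : Prop :=
  ∃ (K : ℕ) (H : ℕ → ℕ → Pt),
    (∀ t, H t 0 = γ t) ∧ (∀ t, H t K = γ 0) ∧
    (∀ k ≤ K, H 0 k = γ 0 ∧ H m k = γ 0) ∧
    (∀ t ≤ m, ∀ k ≤ K, H t k ∈ Z) ∧
    (∀ s t k l, s ≤ m → t ≤ m → k ≤ K → l ≤ K →
      prodAdj j natAdj (s, k) (t, l) → cAdj j (H s k) (H t l))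

/-- The union of the infinite `c_j`-components of the complement of `X`. -/
def InfPart (j : ℕ) (X : Set Pt) : Set Pt := {p | p ∈ Xᶜ ∧ (compOf j Xᶜ p).Infinite}

/-- The outer perimeter of the digital picture `(X, c_i, c_j)`: the least length of a
non-`j`-contractible loop in the infinite component of the complement of `X`, or `1`
if no such loop exists.  (It depends only on `j` and `X`.) -/
noncomputable def outerPerim (j : ℕ) (X : Set Pt) : ℕ := by
  classical
  exact if (∃ m γ, LoopIn j (InfPart j X) m γ ∧ ¬ LoopContractibleIn j (InfPart j X) m γ)
    then sInf {m | ∃ γ, LoopIn j (InfPart j X) m γ ∧ ¬ LoopContractibleIn j (InfPart j X) m γ}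
    else 1

/-- The digital rectangle `I_{n,m} = [1,n]_ℤ × [1,m]_ℤ`. -/
def Irect (n m : ℤ) : Set Pt := Set.Icc 1 n ×ˢ Set.Icc 1 m

/-- A finite digital image is `i`-reducible when it is `i`-homotopy equivalent to a
digital image with strictly fewer points. -/
def Reducible (i : ℕ) {α : Type} (κ : α → α → Prop) : Prop :=
  ∃ (β : Type) (δ : β → β → Prop), Reflexive δ ∧ Symmetric δ ∧ Finite β ∧
    Nat.card β < Nat.card α ∧ HtpyEquiv i κ δ

section Adjacency

theorem cAdj_one_iff {x y : Pt} : cAdj 1 x y ↔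
    (x.1 = y.1 ∧ x.2 ≤ y.2 + 1 ∧ y.2 ≤ x.2 + 1) ∨
      (x.2 = y.2 ∧ x.1 ≤ y.1 + 1 ∧ y.1 ≤ x.1 + 1) := by
  simp only [cAdj, if_true]
  rcases abs_cases (x.1 - y.1) with h | h <;> rcases abs_cases (x.2 - y.2) with h' | h' <;> omega

theorem cAdj_iff_of_ne_one {j : ℕ} (hj : j ≠ 1) {x y : Pt} : cAdj j x y ↔
    x.1 ≤ y.1 + 1 ∧ y.1 ≤ x.1 + 1 ∧ x.2 ≤ y.2 + 1 ∧ y.2 ≤ x.2 + 1 := by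
  simp only [cAdj, if_neg hj, abs_le]
  omega

theorem cAdj_bounds {j : ℕ} {x y : Pt} (h : cAdj j x y) :
    x.1 ≤ y.1 + 1 ∧ y.1 ≤ x.1 + 1 ∧ x.2 ≤ y.2 + 1 ∧ y.2 ≤ x.2 + 1 := by
  by_cases hj : j = 1
  · subst hj
    rw [cAdj_one_iff] at h
    omega
  · exact (cAdj_iff_of_ne_one hj).1 h

theorem cAdj_refl (j : ℕ) (x : Pt) : cAdj j x x := by
  unfold cAdj
  split <;> simp

theorem cAdj_symm {j : ℕ} {x y : Pt} (h : cAdj j x y) : cAdj j y x := by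
  unfold cAdj at *
  rwa [abs_sub_comm y.1, abs_sub_comm y.2]

theorem natAdj_symm {s t : ℕ} (h : natAdj s t) : natAdj t s := by
  unfold natAdj at *
  omega

/-- The pairs of times at which consecutive stages of a `j`-homotopy are compared. -/
def StageAdj (j s t : ℕ) : Prop := s = t ∨ (j ≠ 1 ∧ natAdj s t)

theorem StageAdj.natAdj {j s t : ℕ} (h : StageAdj j s t) : natAdj s t :=
  h.elim Or.inl And.right

theorem StageAdj.symm {j s t : ℕ} (h : StageAdj j s t) : StageAdj j t s :=
  h.imp Eq.symm (And.imp_right natAdj_symm)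

theorem prodAdj_natAdj_iff {j s k t l : ℕ} : prodAdj j natAdj (s, k) (t, l) ↔
    (k = l ∧ natAdj s t) ∨ (natAdj k l ∧ StageAdj j s t) := by
  by_cases hj : j = 1 <;> simp only [prodAdj, StageAdj, natAdj, hj, if_true, if_false] <;> omega

end Adjacency

section Loops

variable {j m : ℕ} {Z : Set Pt} {γ γ' : ℕ → Pt}

theorem LoopIn.cAdj_of_natAdj (hγ : LoopIn j Z m γ) {s t : ℕ} (hs : s ≤ m) (ht : t ≤ m)
    (h : natAdj s t) : cAdj j (γ s) (γ t) := by
  rcases h with rfl | rfl | rfl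
  · exact cAdj_refl j _
  · exact hγ.2.2 s (by omega)
  · exact cAdj_symm (hγ.2.2 t (by omega))

/-- `γ` and `γ'` can be consecutive stages of a `j`-homotopy. -/
def LoopStep (j m : ℕ) (γ γ' : ℕ → Pt) : Prop :=
  ∀ s t, s ≤ m → t ≤ m → StageAdj j s t → cAdj j (γ s) (γ' t)

theorem LoopStep.symm (h : LoopStep j m γ γ') : LoopStep j m γ' γ :=
  fun s t hs ht hst => cAdj_symm (h t s ht hs hst.symm)

/-- `γ` is homotopic to a constant loop through loops whose base point may move. -/
def FreelyContractibleIn (j : ℕ) (Z : Set Pt) (m : ℕ) (γ : ℕ → Pt) : Prop :=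
  ∃ (K : ℕ) (H : ℕ → ℕ → Pt),
    (∀ t, H t 0 = γ t) ∧ (∀ t ≤ m, H t K = H 0 K) ∧
    (∀ k ≤ K, H 0 k = H m k) ∧
    (∀ t ≤ m, ∀ k ≤ K, H t k ∈ Z) ∧
    (∀ s t k l, s ≤ m → t ≤ m → k ≤ K → l ≤ K →
      prodAdj j natAdj (s, k) (t, l) → cAdj j (H s k) (H t l))

theorem homotopy_cons_cAdj {K : ℕ} {H : ℕ → ℕ → Pt} (hγ : LoopIn j Z m γ)
    (hs : LoopStep j m γ γ') (h0 : ∀ t, H t 0 = γ' t)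
    (hH : ∀ s t k l, s ≤ m → t ≤ m → k ≤ K → l ≤ K →
      prodAdj j natAdj (s, k) (t, l) → cAdj j (H s k) (H t l))
    (s t k l : ℕ) (hsm : s ≤ m) (htm : t ≤ m) (hk : k ≤ K + 1) (hl : l ≤ K + 1)
    (h : prodAdj j natAdj (s, k) (t, l)) :
    cAdj j (Nat.casesOn (motive := fun _ => Pt) k (γ s) (H s))
      (Nat.casesOn (motive := fun _ => Pt) l (γ t) (H t)) := by
  rw [prodAdj_natAdj_iff] at h
  rcases k with _ | k <;> rcases l with _ | l
  · exact hγ.cAdj_of_natAdj hsm htm (h.elim And.right fun h => h.2.natAdj)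
  · have hl0 : l = 0 := by unfold natAdj at h; omega
    subst hl0
    simp only [h0]
    exact hs s t hsm htm (h.elim (fun h => by omega) And.right)
  · have hk0 : k = 0 := by unfold natAdj at h; omega
    subst hk0
    simp only [h0]
    exact hs.symm s t hsm htm (h.elim (fun h => by omega) And.right)
  · refine hH s t k l hsm htm (by omega) (by omega) (prodAdj_natAdj_iff.2 ?_)
    refine h.imp (And.imp_left (by omega)) (And.imp_left ?_)
    unfold natAdj
    omega

theorem FreelyContractibleIn.of_step (hγ : LoopIn j Z m γ) (hs : LoopStep j m γ γ')
    (h : FreelyContractibleIn j Z m γ') : FreelyContractibleIn j Z m γ := by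
  obtain ⟨K, H, h0, hK, hb, hZ, hH⟩ := h
  refine ⟨K + 1, fun t k => Nat.casesOn (motive := fun _ => Pt) k (γ t) (H t), fun t => rfl,
    hK, ?_, ?_, homotopy_cons_cAdj hγ hs h0 hH⟩
  · rintro (_ | k) hk
    · exact hγ.1
    · exact hb k (by omega)
  · rintro t ht (_ | k) hk
    · exact hγ.2.1 t ht
    · exact hZ t ht k (by omega)

theorem LoopContractibleIn.of_step (hγ : LoopIn j Z m γ) (hs : LoopStep j m γ γ')
    (hb0 : γ' 0 = γ 0) (h : LoopContractibleIn j Z m γ') : LoopContractibleIn j Z m γ := by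
  obtain ⟨K, H, h0, hK, hb, hZ, hH⟩ := h
  refine ⟨K + 1, fun t k => Nat.casesOn (motive := fun _ => Pt) k (γ t) (H t), fun t => rfl,
    fun t => (hK t).trans hb0, ?_, ?_, homotopy_cons_cAdj hγ hs h0 hH⟩
  · rintro (_ | k) hk
    · exact ⟨rfl, hγ.1.symm⟩
    · exact hb0 ▸ hb k (by omega)
  · rintro t ht (_ | k) hk
    · exact hγ.2.1 t ht
    · exact hZ t ht k (by omega)

theorem LoopContractibleIn.of_const (hγ : LoopIn j Z m γ) (hc : ∀ t ≤ m, γ t = γ 0) :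
    LoopContractibleIn j Z m γ := by
  have hconst : LoopContractibleIn j Z m fun _ => γ 0 :=
    ⟨0, fun _ _ => γ 0, fun _ => rfl, fun _ => rfl, fun _ _ => ⟨rfl, rfl⟩,
      fun _ _ _ _ => hγ.2.1 0 (Nat.zero_le m), fun _ _ _ _ _ _ _ _ _ => cAdj_refl j _⟩
  refine LoopContractibleIn.of_step (γ' := fun _ => γ 0) hγ (fun s t hs ht hst => ?_) rfl hconst
  rw [hc s hs]
  exact cAdj_refl j _

/-- Contractibility is preserved by monotone reparametrization. -/
theorem LoopContractibleIn.comp {m' : ℕ} {r : ℕ → ℕ} (h : LoopContractibleIn j Z m' γ)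
    (hr0 : r 0 = 0) (hrm : r m = m') (hr : ∀ t ≤ m, r t ≤ m')
    (hadj : ∀ s t, natAdj s t → natAdj (r s) (r t)) :
    LoopContractibleIn j Z m (γ ∘ r) := by
  obtain ⟨K, H, h0, hK, hb, hZ, hH⟩ := h
  refine ⟨K, fun t => H (r t), fun t => h0 _, fun t => ?_, fun k hk => ?_,
    fun t ht k hk => hZ _ (hr t ht) k hk, fun s t k l hs ht hk hl hst => ?_⟩
  · simp [hK, hr0]
  · simp only [Function.comp, hr0, hrm]
    exact hb k hk
  · refine hH _ _ k l (hr s hs) (hr t ht) hk hl (prodAdj_natAdj_iff.2 ?_)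
    exact (prodAdj_natAdj_iff.1 hst).imp (And.imp_right (hadj s t))
      (And.imp_right (Or.imp (congrArg r) (And.imp_right (hadj s t))))

/-- If all loops shorter than `m` contract, so does every loop of length `m` revisiting a point. -/
theorem LoopIn.contractible_of_revisit
    (hmin : ∀ m' < m, ∀ β, LoopIn j Z m' β → LoopContractibleIn j Z m' β)
    (hγ : LoopIn j Z m γ) {s t : ℕ} (hst : s < t) (htm : t ≤ m) (hlt : t - s < m)
    (heq : γ s = γ t) : LoopContractibleIn j Z m γ := by
  have hinner : LoopIn j Z (t - s) fun u => γ (s + u) :=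
    ⟨by simp only [Nat.add_zero, Nat.add_sub_cancel' hst.le, heq],
      fun u hu => hγ.2.1 _ (by omega), fun u hu => hγ.2.2 (s + u) (by omega)⟩
  obtain ⟨K, H, h0, hK, hb, hZ, hH⟩ := hmin _ hlt _ hinner
  simp only [Nat.add_zero] at hK hb
  let stage (k u : ℕ) : Pt := if s ≤ u ∧ u ≤ t then H (u - s) k else γ u
  have hin {k u : ℕ} (h : s ≤ u ∧ u ≤ t) : stage k u = H (u - s) k := if_pos h
  have hout {k u : ℕ} (h : ¬(s ≤ u ∧ u ≤ t)) : stage k u = γ u := if_neg h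
  have hend {k u : ℕ} (hk : k ≤ K) (hu : u ≤ s ∨ t ≤ u) : stage k u = γ u := by
    by_cases h : s ≤ u ∧ u ≤ t
    · rw [hin h]
      rcases hu with hu | hu
      · obtain rfl : u = s := by omega
        rw [Nat.sub_self]
        exact (hb k hk).1
      · obtain rfl : u = t := by omega
        rw [← heq]
        exact (hb k hk).2
    · exact hout h
  have hadj (u v k l : ℕ) (hu : u ≤ m) (hv : v ≤ m) (hk : k ≤ K) (hl : l ≤ K)
      (h : prodAdj j natAdj (u, k) (v, l)) : cAdj j (stage k u) (stage l v) := by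
    have h' := prodAdj_natAdj_iff.1 h
    have huv : natAdj u v := h'.elim And.right fun h => h.2.natAdj
    by_cases huv' : (s ≤ u ∧ u ≤ t) ∧ s ≤ v ∧ v ≤ t
    · rw [hin huv'.1, hin huv'.2]
      refine hH _ _ k l (by omega) (by omega) hk hl (prodAdj_natAdj_iff.2 ?_)
      unfold StageAdj natAdj at *
      omega
    · rw [hend hk (by unfold natAdj at huv; omega), hend hl (by unfold natAdj at huv; omega)]
      exact hγ.cAdj_of_natAdj hu hv huv
  have hloop (k : ℕ) (hk : k ≤ K) : LoopIn j Z m (stage k) := by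
    refine ⟨?_, fun u hu => ?_, fun u hu => hadj u (u + 1) k k (by omega) (by omega) hk hk
      (prodAdj_natAdj_iff.2 (Or.inl ⟨rfl, Or.inr (Or.inl rfl)⟩))⟩
    · rw [hend hk (by omega), hend hk (by omega)]
      exact hγ.1
    · by_cases h : s ≤ u ∧ u ≤ t
      · rw [hin h]
        exact hZ _ (by omega) k hk
      · rw [hout h]
        exact hγ.2.1 u hu
  have houter : LoopIn j Z (m - (t - s)) fun u => if u ≤ s then γ u else γ (u + (t - s)) := by
    refine ⟨?_, fun u hu => ?_, fun u hu => ?_⟩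
    · dsimp only
      rw [if_pos (Nat.zero_le s), hγ.1]
      split
      · obtain rfl : t = m := by omega
        rw [← heq]
        congr 1
        omega
      · congr 1
        omega
    · dsimp only
      split <;> exact hγ.2.1 _ (by omega)
    · dsimp only
      rcases lt_trichotomy u s with h | rfl | h
      · rw [if_pos (by omega), if_pos (by omega)]
        exact hγ.2.2 u (by omega)
      · rw [if_pos le_rfl, if_neg (by omega), heq]
        convert hγ.2.2 t (by omega) using 2
        omega
      · rw [if_neg (by omega), if_neg (by omega)]
        convert hγ.2.2 (u + (t - s)) (by omega) using 2
        omega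
  have hlast : LoopContractibleIn j Z m (stage K) := by
    have := (hmin _ (by omega) _ houter).comp (m := m)
      (r := fun u => if u ≤ s then u else if u ≤ t then s else u - (t - s))
      (by simp) (by split_ifs <;> omega)
      (fun u hu => by split_ifs <;> omega)
      (fun u v huv => by unfold natAdj at *; split_ifs <;> omega)
    convert this using 1
    funext u
    simp only [Function.comp]
    by_cases h1 : u ≤ s
    · rw [hend le_rfl (Or.inl h1), if_pos h1, if_pos h1]
    · by_cases h2 : u ≤ t
      · rw [hin ⟨by omega, h2⟩, hK, if_neg h1, if_pos h2, if_pos le_rfl]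
      · rw [hend le_rfl (by omega), if_neg h1, if_neg h2, if_neg (by omega)]
        congr 1
        omega
  have hall (n : ℕ) (hn : n ≤ K) : LoopContractibleIn j Z m (stage (K - n)) := by
    induction n with
    | zero => exact hlast
    | succ n ih =>
      refine (ih (by omega)).of_step (hloop _ (by omega)) (fun u v hu hv huv => ?_) ?_
      · refine hadj u v _ _ hu hv (by omega) (by omega) (prodAdj_natAdj_iff.2 (Or.inr ⟨?_, huv⟩))
        unfold natAdj
        omega
      · rw [hend (by omega) (by omega), hend (by omega) (by omega)]
  have hfirst := hall K le_rfl
  rw [Nat.sub_self] at hfirst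
  convert hfirst using 1
  funext u
  by_cases h : s ≤ u ∧ u ≤ t
  · rw [hin h, h0]
    congr 1
    omega
  · exact (hout h).symm

end Loops

section Winding

/-- Signed crossing number of the step `u → v` with the vertical ray above `q`, counted on the
right-hand side of the ray. -/
def crossing (q u v : Pt) : ℤ :=
  if u.1 = q.1 ∧ q.2 < u.2 ∧ v.1 = q.1 + 1 then 1
  else if v.1 = q.1 ∧ q.2 < v.2 ∧ u.1 = q.1 + 1 then -1 else 0

theorem crossing_of_above {j : ℕ} {q u v : Pt} (huv : cAdj j u v) (hu : u.1 = q.1 → q.2 < u.2)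
    (hv : v.1 = q.1 → q.2 < v.2) :
    crossing q u v = (if q.1 < v.1 then 1 else 0) - (if q.1 < u.1 then 1 else 0) := by
  have := cAdj_bounds huv
  unfold crossing
  split_ifs <;> omega

theorem crossing_of_below {q u v : Pt} (hu : u.1 = q.1 → u.2 < q.2)
    (hv : v.1 = q.1 → v.2 < q.2) : crossing q u v = 0 := by
  unfold crossing
  split_ifs <;> omega

/-- Two points of the column of `q` lie on the same side of `q`. -/
def SameSide (q u v : Pt) : Prop := u.1 = q.1 → v.1 = q.1 → (q.2 < u.2 ↔ q.2 < v.2)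

theorem sameSide_of_cAdj {j : ℕ} {q u v : Pt} (huv : cAdj j u v) (hu : u ≠ q) (hv : v ≠ q) :
    SameSide q u v := by
  have := cAdj_bounds huv
  rw [ne_eq, Prod.ext_iff] at hu hv
  intro h1 h2
  omega

theorem sameSide_of_cAdj_one {q u v w : Pt} (huw : cAdj 1 u w) (hwv : cAdj 1 w v)
    (hu : u ≠ q) (hv : v ≠ q) (hw : w ≠ q) : SameSide q u v := by
  rw [cAdj_one_iff] at huw hwv
  rw [ne_eq, Prod.ext_iff] at hu hv hw
  intro h1 h2
  omega

theorem crossing_square {j : ℕ} {q a b c d : Pt} (ha : a ≠ q) (hb : b ≠ q) (hc : c ≠ q)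
    (hd : d ≠ q) (hab : cAdj j a b) (hbd : cAdj j b d) (hac : cAdj j a c) (hcd : cAdj j c d)
    (hdiag : j ≠ 1 → cAdj j a d ∧ cAdj j b c) :
    crossing q a b + crossing q b d = crossing q a c + crossing q c d := by
  have hdiag' : SameSide q a d ∧ SameSide q b c := by
    by_cases hj : j = 1
    · subst hj
      exact ⟨sameSide_of_cAdj_one hab hbd ha hd hb,
        sameSide_of_cAdj_one (cAdj_symm hab) hac hb hc ha⟩
    · exact ⟨sameSide_of_cAdj (hdiag hj).1 ha hd, sameSide_of_cAdj (hdiag hj).2 hb hc⟩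
  have h1 := sameSide_of_cAdj hab ha hb
  have h2 := sameSide_of_cAdj hbd hb hd
  have h3 := sameSide_of_cAdj hac ha hc
  have h4 := sameSide_of_cAdj hcd hc hd
  by_cases habove : (a.1 = q.1 → q.2 < a.2) ∧ (b.1 = q.1 → q.2 < b.2) ∧
      (c.1 = q.1 → q.2 < c.2) ∧ (d.1 = q.1 → q.2 < d.2)
  · obtain ⟨ka, kb, kc, kd⟩ := habove
    rw [crossing_of_above hab ka kb, crossing_of_above hbd kb kd, crossing_of_above hac ka kc,
      crossing_of_above hcd kc kd]
    ring
  · have hbelow : (a.1 = q.1 → a.2 < q.2) ∧ (b.1 = q.1 → b.2 < q.2) ∧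
        (c.1 = q.1 → c.2 < q.2) ∧ (d.1 = q.1 → d.2 < q.2) := by
      rw [ne_eq, Prod.ext_iff] at ha hb hc hd
      unfold SameSide at *
      refine ⟨?_, ?_, ?_, ?_⟩ <;> intro h <;> grind
    obtain ⟨ka, kb, kc, kd⟩ := hbelow
    rw [crossing_of_below ka kb, crossing_of_below kb kd, crossing_of_below ka kc,
      crossing_of_below kc kd]

theorem crossing_self (q u : Pt) : crossing q u u = 0 := by
  unfold crossing
  split_ifs <;> omega

theorem FreelyContractibleIn.sum_crossing_eq_zero {j m : ℕ} {Z : Set Pt} {γ : ℕ → Pt}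
    (h : FreelyContractibleIn j Z m γ) {q : Pt} (hq : q ∉ Z) :
    ∑ s ∈ Finset.range m, crossing q (γ s) (γ (s + 1)) = 0 := by
  obtain ⟨K, H, h0, hK, hb, hZ, hH⟩ := h
  have hne {t k : ℕ} (ht : t ≤ m) (hk : k ≤ K) : H t k ≠ q :=
    fun h => hq (h ▸ hZ t ht k hk)
  have hadj (s t k l : ℕ) (hs : s ≤ m) (ht : t ≤ m) (hk : k ≤ K) (hl : l ≤ K)
      (h : (k = l ∧ natAdj s t) ∨ (natAdj k l ∧ StageAdj j s t)) : cAdj j (H s k) (H t l) :=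
    hH s t k l hs ht hk hl (prodAdj_natAdj_iff.2 h)
  have hstep (k : ℕ) (hk : k < K) (n : ℕ) (hn : n ≤ m) :
      ∑ s ∈ Finset.range n, crossing q (H s k) (H (s + 1) k) + crossing q (H n k) (H n (k + 1)) =
        crossing q (H 0 k) (H 0 (k + 1)) +
          ∑ s ∈ Finset.range n, crossing q (H s (k + 1)) (H (s + 1) (k + 1)) := by
    induction n with
    | zero => simp
    | succ n ih =>
      have hsq := crossing_square (j := j) (q := q)
        (hne (t := n) (k := k) (by omega) (by omega))
        (hne (t := n + 1) (k := k) (by omega) (by omega))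
        (hne (t := n) (k := k + 1) (by omega) (by omega))
        (hne (t := n + 1) (k := k + 1) (by omega) (by omega))
        (hadj _ _ _ _ (by omega) (by omega) (by omega) (by omega) (by simp [natAdj]))
        (hadj _ _ _ _ (by omega) (by omega) (by omega) (by omega) (by simp [natAdj, StageAdj]))
        (hadj _ _ _ _ (by omega) (by omega) (by omega) (by omega) (by simp [natAdj, StageAdj]))
        (hadj _ _ _ _ (by omega) (by omega) (by omega) (by omega) (by simp [natAdj]))
        (fun hj => ⟨hadj _ _ _ _ (by omega) (by omega) (by omega) (by omega)
            (by simp [natAdj, StageAdj, hj]),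
          hadj _ _ _ _ (by omega) (by omega) (by omega) (by omega)
            (by simp [natAdj, StageAdj, hj])⟩)
      have := ih (by omega)
      rw [Finset.sum_range_succ, Finset.sum_range_succ]
      linarith
  have hall (n : ℕ) (hn : n ≤ K) :
      ∑ s ∈ Finset.range m, crossing q (H s (K - n)) (H (s + 1) (K - n)) = 0 := by
    induction n with
    | zero =>
      refine Finset.sum_eq_zero fun s hs => ?_
      rw [Finset.mem_range] at hs
      rw [Nat.sub_zero, hK s hs.le, hK (s + 1) hs]
      exact crossing_self q _
    | succ n ih =>
      have h := hstep (K - (n + 1)) (by omega) m le_rfl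
      rw [hb _ (by omega), hb _ (by omega), show K - (n + 1) + 1 = K - n by omega,
        ih (by omega)] at h
      linarith
  simpa only [Nat.sub_self, h0] using hall K le_rfl

end Winding

section Shrinking

variable {j m : ℕ} {Z Z' : Set Pt} {γ γ' : ℕ → Pt} {F : Pt → Pt}

theorem LoopIn.map (hF : Set.MapsTo F Z Z')
    (hadj : ∀ x ∈ Z, ∀ y ∈ Z, cAdj j x y → cAdj j (F x) (F y)) (hγ : LoopIn j Z m γ) :
    LoopIn j Z' m (F ∘ γ) :=
  ⟨congrArg F hγ.1, fun t ht => hF (hγ.2.1 t ht), fun t ht =>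
    hadj _ (hγ.2.1 t ht.le) _ (hγ.2.1 (t + 1) ht) (hγ.2.2 t ht)⟩

theorem LoopContractibleIn.map (hF : Set.MapsTo F Z Z')
    (hadj : ∀ x ∈ Z, ∀ y ∈ Z, cAdj j x y → cAdj j (F x) (F y))
    (h : LoopContractibleIn j Z m γ) : LoopContractibleIn j Z' m (F ∘ γ) := by
  obtain ⟨K, H, h0, hK, hb, hZ, hH⟩ := h
  exact ⟨K, fun t k => F (H t k), fun t => congrArg F (h0 t), fun t => congrArg F (hK t),
    fun k hk => ⟨congrArg F (hb k hk).1, congrArg F (hb k hk).2⟩,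
    fun t ht k hk => hF (hZ t ht k hk), fun s t k l hs ht hk hl hst =>
      hadj _ (hZ s hs k hk) _ (hZ t ht l hl) (hH s t k l hs ht hk hl hst)⟩

theorem FreelyContractibleIn.map (hF : Set.MapsTo F Z Z')
    (hadj : ∀ x ∈ Z, ∀ y ∈ Z, cAdj j x y → cAdj j (F x) (F y))
    (h : FreelyContractibleIn j Z m γ) : FreelyContractibleIn j Z' m (F ∘ γ) := by
  obtain ⟨K, H, h0, hK, hb, hZ, hH⟩ := h
  exact ⟨K, fun t k => F (H t k), fun t => congrArg F (h0 t), fun t ht => congrArg F (hK t ht),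
    fun k hk => congrArg F (hb k hk),
    fun t ht k hk => hF (hZ t ht k hk), fun s t k l hs ht hk hl hst =>
      hadj _ (hZ s hs k hk) _ (hZ t ht l hl) (hH s t k l hs ht hk hl hst)⟩

theorem LoopContractibleIn.freely (h : LoopContractibleIn j Z m γ) :
    FreelyContractibleIn j Z m γ := by
  obtain ⟨K, H, h0, hK, hb, hZ, hH⟩ := h
  exact ⟨K, H, h0, fun t _ => (hK t).trans (hK 0).symm,
    fun k hk => (hb k hk).1.trans (hb k hk).2.symm, hZ, hH⟩

/-- The `ℓ¹`-distance in the digital plane. -/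
def taxicab (x y : Pt) : ℕ := (x.1 - y.1).natAbs + (x.2 - y.2).natAbs

/-- The total `ℓ¹`-distance from the points of a loop to its base point. -/
def spread (m : ℕ) (γ : ℕ → Pt) : ℕ := ∑ t ∈ Finset.range (m + 1), taxicab (γ t) (γ 0)

theorem spread_lt (h0 : γ' 0 = γ 0)
    (h : ∀ t ≤ m, γ' t = γ t ∨ γ' t = ((γ t).1, (γ t).2 - 1) ∧ (γ 0).2 < (γ t).2)
    (hex : ∃ t ≤ m, γ' t = ((γ t).1, (γ t).2 - 1) ∧ (γ 0).2 < (γ t).2) :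
    spread m γ' < spread m γ := by
  have hlt {t : ℕ} (ht : γ' t = ((γ t).1, (γ t).2 - 1) ∧ (γ 0).2 < (γ t).2) :
      taxicab (γ' t) (γ' 0) < taxicab (γ t) (γ 0) := by
    rw [ht.1, h0]
    simp only [taxicab]
    omega
  obtain ⟨t, ht, hdown⟩ := hex
  refine Finset.sum_lt_sum (fun s hs => ?_) ⟨t, Finset.mem_range.2 (by omega), hlt hdown⟩
  rcases h s (by simpa [Nat.lt_succ_iff] using hs) with hs | hs
  · rw [hs, h0]
  · exact (hlt hs).le

/-- The point below a topmost point which is traversed horizontally and visited only once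
cannot be missing, as the loop would wind around it. -/
theorem FreelyContractibleIn.below_mem (hF : FreelyContractibleIn j Z m γ) {h : ℤ}
    (hh : ∀ s ≤ m, (γ s).2 ≤ h) {t : ℕ} (ht0 : 0 < t) (htm : t < m) (hth : (γ t).2 = h)
    (honce : ∀ s ≤ m, γ s = γ t → s = t)
    (hcross : ((γ (t - 1)).1 = (γ t).1 - 1 ∧ (γ (t + 1)).1 = (γ t).1 + 1) ∨
      ((γ (t - 1)).1 = (γ t).1 + 1 ∧ (γ (t + 1)).1 = (γ t).1 - 1)) :
    ((γ t).1, h - 1) ∈ Z := by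
  by_contra hq
  have hsum := hF.sum_crossing_eq_zero hq
  have hon {s : ℕ} (hs : s ≤ m) (h1 : (γ s).1 = (γ t).1) (h2 : h - 1 < (γ s).2) : s = t :=
    honce s hs (Prod.ext h1 (by have := hh s hs; omega))
  rw [Finset.sum_eq_add (t - 1) t (by omega) ?_ ?_ ?_] at hsum
  · rw [Nat.sub_add_cancel ht0] at hsum
    rcases hcross with ⟨hp, hn⟩ | ⟨hp, hn⟩ <;> simp [crossing, hp, hn, hth] at hsum <;> omega
  · intro s hs hst
    rw [Finset.mem_range] at hs
    unfold crossing
    rw [if_neg, if_neg]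
    · rintro ⟨h1, h2, -⟩
      have := hon hs h1 h2
      omega
    · rintro ⟨h1, h2, -⟩
      exact hst.2 (hon hs.le h1 h2)
  · intro hs
    exact absurd (Finset.mem_range.2 (by omega)) hs
  · intro hs
    exact absurd (Finset.mem_range.2 htm) hs

/-- A shortest non-contractible loop which is freely contractible can be pushed down
from its topmost row. -/
theorem LoopIn.exists_push_down
    (hmin : ∀ m' < m, ∀ β, LoopIn j Z m' β → LoopContractibleIn j Z m' β)
    (hγ : LoopIn j Z m γ) (hF : FreelyContractibleIn j Z m γ)
    (hnc : ¬ LoopContractibleIn j Z m γ) (htop : ∃ t ≤ m, (γ 0).2 < (γ t).2) :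
    ∃ γ', LoopIn j Z m γ' ∧ LoopStep j m γ γ' ∧ γ' 0 = γ 0 ∧ spread m γ' < spread m γ := by
  obtain ⟨t₁, ht₁, hmax⟩ := Finset.exists_max_image (Finset.range (m + 1)) (fun t => (γ t).2)
    ⟨0, by simp⟩
  have hh : ∀ s ≤ m, (γ s).2 ≤ (γ t₁).2 := fun s hs => hmax s (Finset.mem_range.2 (by omega))
  replace ht₁ : t₁ ≤ m := by simpa [Nat.lt_succ_iff] using ht₁
  obtain ⟨h, hh₁⟩ : ∃ h, (γ t₁).2 = h := ⟨_, rfl⟩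
  rw [hh₁] at hh
  have h0 : (γ 0).2 < h := by
    obtain ⟨t, ht, hlt⟩ := htop
    exact hlt.trans_le (hh t ht)
  have hm : (γ m).2 < h := by rwa [← hγ.1]
  have hinner {t : ℕ} (ht : t ≤ m) (hth : (γ t).2 = h) : 0 < t ∧ t < m := by
    constructor
    · rcases Nat.eq_zero_or_pos t with rfl | h
      · omega
      · exact h
    · rcases ht.eq_or_lt with rfl | h
      · omega
      · exact h
  have hinj {s t : ℕ} (hst : s < t) (ht : t ≤ m) (hlt : t - s < m) : γ s ≠ γ t := fun heq =>
    hnc (hγ.contractible_of_revisit hmin hst ht hlt heq)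
  have honce {t : ℕ} (ht : t ≤ m) (hth : (γ t).2 = h) : ∀ s ≤ m, γ s = γ t → s = t := by
    intro s hs heq
    have h1 := hinner ht hth
    rcases lt_trichotomy s t with hst | hst | hst
    · exact absurd heq (hinj hst ht (by omega))
    · exact hst
    · exact absurd heq.symm (hinj hst hs (by omega))
  by_cases hj : j = 1
  · subst hj
    have hbelow {t : ℕ} (ht : t ≤ m) (hth : (γ t).2 = h) : ((γ t).1, h - 1) ∈ Z := by
      obtain ⟨ht0, htm⟩ := hinner ht hth
      have hp := hγ.2.2 (t - 1) (by omega)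
      have hn := hγ.2.2 t htm
      rw [Nat.sub_add_cancel ht0, cAdj_one_iff] at hp
      rw [cAdj_one_iff] at hn
      have hph := hh (t - 1) (by omega)
      have hnh := hh (t + 1) htm
      have hpt := hinj (s := t - 1) (t := t) (by omega) ht (by omega)
      have htn := hinj (s := t) (t := t + 1) (by omega) htm (by omega)
      by_cases hp' : γ (t - 1) = ((γ t).1, h - 1)
      · exact hp' ▸ hγ.2.1 (t - 1) (by omega)
      by_cases hn' : γ (t + 1) = ((γ t).1, h - 1)
      · exact hn' ▸ hγ.2.1 (t + 1) htm
      rw [ne_eq, Prod.ext_iff] at hpt htn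
      rw [Prod.ext_iff] at hp' hn'
      dsimp only at hp' hn'
      have hp2 : (γ (t - 1)).2 = h := by omega
      have hn2 : (γ (t + 1)).2 = h := by omega
      have hpi := hinner (by omega) hp2
      have hni := hinner (by omega) hn2
      have hpn := hinj (s := t - 1) (t := t + 1) (by omega) htm (by omega)
      rw [ne_eq, Prod.ext_iff] at hpn
      exact hF.below_mem hh ht0 htm hth (honce ht hth) (by omega)
    refine ⟨fun t => if (γ t).2 = h then ((γ t).1, h - 1) else γ t, ⟨?_, ?_, ?_⟩, ?_,
      if_neg h0.ne, ?_⟩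
    · dsimp only
      rw [if_neg h0.ne, if_neg hm.ne]
      exact hγ.1
    · intro t ht
      dsimp only
      split
      · exact hbelow ht ‹_›
      · exact hγ.2.1 t ht
    · intro t ht
      have hadj := hγ.2.2 t ht
      have hth := hh t ht.le
      have hnh := hh (t + 1) ht
      rw [cAdj_one_iff] at hadj ⊢
      dsimp only
      split_ifs <;> omega
    · intro s t hs ht hst
      obtain rfl : s = t := hst.elim id fun h => absurd rfl h.1
      rw [cAdj_one_iff]
      dsimp only
      split_ifs <;> omega
    · refine spread_lt (if_neg h0.ne) (fun t ht => ?_) ⟨t₁, ht₁, ?_⟩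
      · by_cases hth : (γ t).2 = h
        · right
          rw [if_pos hth, hth]
          exact ⟨rfl, h0⟩
        · left
          rw [if_neg hth]
      · rw [if_pos hh₁, hh₁]
        exact ⟨rfl, h0⟩
  · classical
    have hex : ∃ t, t ≤ m ∧ (γ t).2 = h := ⟨t₁, ht₁, hh₁⟩
    obtain ⟨t, ⟨ht, hth⟩, hfirst⟩ : ∃ t, (t ≤ m ∧ (γ t).2 = h) ∧ ∀ s < t, (γ s).2 ≠ h :=
      ⟨Nat.find hex, Nat.find_spec hex, fun s hs heq =>
        Nat.find_min hex hs ⟨hs.le.trans (Nat.find_spec hex).1, heq⟩⟩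
    obtain ⟨ht0, htm⟩ := hinner ht hth
    have hadjp := hγ.2.2 (t - 1) (by omega)
    have hadjn := hγ.2.2 t htm
    rw [Nat.sub_add_cancel ht0] at hadjp
    have hp2 : (γ (t - 1)).2 = h - 1 := by
      have := cAdj_bounds hadjp
      have := hh (t - 1) (by omega)
      have := hfirst (t - 1) (by omega)
      omega
    have hupd {w : Pt} (hw : w ∈ Z) (hwp : cAdj j (γ (t - 1)) w) (hwt : cAdj j (γ t) w)
        (hwn : cAdj j w (γ (t + 1))) : LoopIn j Z m (Function.update γ t w) ∧
          LoopStep j m γ (Function.update γ t w) ∧ Function.update γ t w 0 = γ 0 := by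
      have hstep (s u : ℕ) (hs : s ≤ m) (hu : u ≤ m) (hsu : natAdj s u) :
          cAdj j (γ s) (Function.update γ t w u) := by
        rcases eq_or_ne u t with rfl | hut
        · rw [Function.update_self]
          rcases hsu with rfl | hsu | rfl
          · exact hwt
          · obtain rfl : s = u - 1 := by omega
            exact hwp
          · exact cAdj_symm hwn
        · rw [Function.update_of_ne hut]
          exact hγ.cAdj_of_natAdj hs hu hsu
      refine ⟨⟨?_, fun s hs => ?_, fun s hs => ?_⟩, fun s u hs hu hsu =>
        hstep s u hs hu hsu.natAdj, Function.update_of_ne (by omega) _ _⟩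
      · rw [Function.update_of_ne (by omega), Function.update_of_ne (by omega)]
        exact hγ.1
      · rcases eq_or_ne s t with rfl | hst
        · rwa [Function.update_self]
        · rw [Function.update_of_ne hst]
          exact hγ.2.1 s hs
      · rcases eq_or_ne s t with rfl | hst
        · rw [Function.update_self, Function.update_of_ne (by omega)]
          exact hwn
        · rw [Function.update_of_ne hst]
          exact hstep s (s + 1) hs.le hs (Or.inr (Or.inl rfl))
    by_cases hpn : cAdj j (γ (t - 1)) (γ (t + 1))
    · obtain ⟨hloop, hstep, hbase⟩ := hupd (hγ.2.1 (t - 1) (by omega)) (cAdj_refl j _)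
        (cAdj_symm hadjp) hpn
      refine absurd (LoopContractibleIn.of_step hγ hstep hbase ?_) hnc
      refine hloop.contractible_of_revisit hmin (s := t - 1) (t := t) (by omega) ht (by omega) ?_
      rw [Function.update_self, Function.update_of_ne (by omega)]
    · have hnh := hh (t + 1) htm
      rw [cAdj_iff_of_ne_one hj] at hadjp hadjn hpn
      have hw : ((γ t).1, h - 1) ∈ Z :=
        hF.below_mem hh ht0 htm hth (honce ht hth) (by omega)
      obtain ⟨hloop, hstep, hbase⟩ := hupd hw
        ((cAdj_iff_of_ne_one hj).2 (by dsimp only; omega))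
        ((cAdj_iff_of_ne_one hj).2 (by dsimp only; omega))
        ((cAdj_iff_of_ne_one hj).2 (by dsimp only; omega))
      have hdown : Function.update γ t ((γ t).1, h - 1) t = ((γ t).1, (γ t).2 - 1) ∧
          (γ 0).2 < (γ t).2 := by
        rw [Function.update_self, hth]
        exact ⟨rfl, h0⟩
      refine ⟨_, hloop, hstep, hbase, spread_lt hbase (fun s hs => ?_) ⟨t, ht, hdown⟩⟩
      rcases eq_or_ne s t with rfl | hst
      · exact Or.inr hdown
      · exact Or.inl (Function.update_of_ne hst _ _)

/-- If all loops shorter than `m` contract, then so do freely contractible loops of length `m`. -/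
theorem LoopIn.contractible_of_freely
    (hmin : ∀ m' < m, ∀ β, LoopIn j Z m' β → LoopContractibleIn j Z m' β)
    (hγ : LoopIn j Z m γ) (hF : FreelyContractibleIn j Z m γ) : LoopContractibleIn j Z m γ := by
  obtain ⟨n, hn⟩ : ∃ n, spread m γ = n := ⟨_, rfl⟩
  induction n using Nat.strong_induction_on generalizing Z γ with
  | _ n ih =>
    by_contra hnc
    have hsymm (φ : Pt ≃ Pt) (hφ : ∀ x y, cAdj j (φ x) (φ y) ↔ cAdj j x y)
        (hd : ∀ x y, taxicab (φ x) (φ y) = taxicab x y) : ¬∃ t ≤ m, (φ (γ 0)).2 < (φ (γ t)).2 := by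
      intro htop
      have hto : Set.MapsTo φ Z (φ.symm ⁻¹' Z) := fun x hx => by simpa using hx
      have hof : Set.MapsTo φ.symm (φ.symm ⁻¹' Z) Z := fun x hx => hx
      have hadj : ∀ x ∈ Z, ∀ y ∈ Z, cAdj j x y → cAdj j (φ x) (φ y) :=
        fun x _ y _ => (hφ x y).2
      have hadj' : ∀ x ∈ φ.symm ⁻¹' Z, ∀ y ∈ φ.symm ⁻¹' Z, cAdj j x y →
          cAdj j (φ.symm x) (φ.symm y) := fun x _ y _ h => by
        rw [← hφ]
        simpa using h
      have hback {m' : ℕ} {β : ℕ → Pt}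
          (h : LoopContractibleIn j Z m' (φ.symm ∘ β)) :
          LoopContractibleIn j (φ.symm ⁻¹' Z) m' β := by
        simpa [← Function.comp_assoc] using h.map hto hadj
      have hmin' : ∀ m' < m, ∀ β, LoopIn j (φ.symm ⁻¹' Z) m' β →
          LoopContractibleIn j (φ.symm ⁻¹' Z) m' β :=
        fun m' hm' β hβ => hback (hmin m' hm' _ (hβ.map hof hadj'))
      have hnc' : ¬LoopContractibleIn j (φ.symm ⁻¹' Z) m (φ ∘ γ) := fun h =>
        hnc (by simpa [← Function.comp_assoc] using h.map hof hadj')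
      have hloop := hγ.map hto hadj
      have hfree := hF.map hto hadj
      obtain ⟨γ', hγ', hstep, hbase, hlt⟩ := hloop.exists_push_down hmin' hfree hnc' htop
      have hsp : spread m (φ ∘ γ) = n := by
        rw [← hn]
        exact Finset.sum_congr rfl fun t _ => hd _ _
      exact hnc' ((ih _ (hsp ▸ hlt) hmin' hγ' (hfree.of_step hγ' hstep.symm) rfl).of_step
        hloop hstep hbase)
    have hswap (x y : Pt) : cAdj j (x.2, x.1) (y.2, y.1) ↔ cAdj j x y := by
      simp only [cAdj, and_comm, add_comm]
    have hflip (x y : Pt) : cAdj j (x.1, -x.2) (y.1, -y.2) ↔ cAdj j x y := by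
      simp only [cAdj, neg_sub_neg, abs_sub_comm y.2]
    have hup := hsymm (Equiv.refl _) (fun _ _ => Iff.rfl) (fun _ _ => rfl)
    have hdown := hsymm ⟨fun x => (x.1, -x.2), fun x => (x.1, -x.2), fun x => by simp,
      fun x => by simp⟩ hflip (fun x y => by simp only [taxicab, Equiv.coe_fn_mk]; omega)
    have hright := hsymm ⟨fun x => (x.2, x.1), fun x => (x.2, x.1), fun x => rfl, fun x => rfl⟩
      hswap (fun x y => by simp only [taxicab, Equiv.coe_fn_mk]; omega)
    have hleft := hsymm ⟨fun x => (x.2, -x.1), fun x => (-x.2, x.1), fun x => by simp,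
      fun x => by simp⟩ (fun x y => (hflip (x.2, x.1) (y.2, y.1)).trans (hswap x y))
      (fun x y => by simp only [taxicab, Equiv.coe_fn_mk]; omega)
    push Not at hup hdown hright hleft
    simp only [Equiv.refl_apply, Equiv.coe_fn_mk] at hup hdown hright hleft
    refine hnc (LoopContractibleIn.of_const hγ fun t ht => Prod.ext ?_ ?_)
    · have := hright t ht
      have := hleft t ht
      omega
    · have := hup t ht
      have := hdown t ht
      omega

end Shrinking

section Invariance

variable {j : ℕ}

theorem ChainIn.cons {A : Set Pt} {x y z : Pt} (hx : x ∈ A) (hxy : cAdj j x y)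
    (h : ChainIn j A y z) : ChainIn j A x z := by
  obtain ⟨n, c, h0, hn, hA, hadj⟩ := h
  refine ⟨n + 1, fun k => Nat.casesOn (motive := fun _ => Pt) k x c, rfl, hn, ?_, ?_⟩
  · rintro (_ | k) hk
    · exact hx
    · exact hA k (by omega)
  · rintro (_ | k) hk
    · dsimp only
      rwa [h0]
    · exact hadj k (by omega)

theorem ChainIn.map {A B : Set Pt} {F : Pt → Pt} (hF : Set.MapsTo F A B)
    (hadj : ∀ x ∈ A, ∀ y ∈ A, cAdj j x y → cAdj j (F x) (F y)) {x y : Pt}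
    (h : ChainIn j A x y) : ChainIn j B (F x) (F y) := by
  obtain ⟨n, c, rfl, rfl, hA, hc⟩ := h
  exact ⟨n, F ∘ c, rfl, rfl, fun k hk => hF (hA k hk), fun k hk =>
    hadj _ (hA k hk.le) _ (hA (k + 1) hk) (hc k hk)⟩

theorem ChainIn.mem_right {A : Set Pt} {x y : Pt} (h : ChainIn j A x y) : y ∈ A := by
  obtain ⟨n, c, -, rfl, hA, -⟩ := h
  exact hA n le_rfl

theorem mem_infPart_of_cAdj {X : Set Pt} {p q : Pt} (hp : p ∈ InfPart j X) (hq : q ∈ Xᶜ)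
    (h : cAdj j p q) : q ∈ InfPart j X :=
  ⟨hq, hp.2.mono fun _ hy => ChainIn.cons hq (cAdj_symm h) hy⟩

/-- `S` is a homotopy of length `M` from `Φ` to the identity of `A`. -/
def IsDeformation (j : ℕ) (A : Set Pt) (M : ℕ) (S : Pt → ℕ → Pt) (Φ : Pt → Pt) : Prop :=
  (∀ x ∈ A, S x 0 = Φ x) ∧ (∀ x ∈ A, S x M = x) ∧ (∀ x ∈ A, ∀ k, S x k ∈ A) ∧
    ∀ x ∈ A, ∀ y ∈ A, ∀ s t, s ≤ M → t ≤ M → prodAdj j (cAdj j) (x, s) (y, t) →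
      cAdj j (S x s) (S y t)

theorem prodAdj_of_cAdj {x y : Pt} (h : cAdj j x y) (k : ℕ) :
    prodAdj j (cAdj j) (x, k) (y, k) := by
  unfold prodAdj
  split
  · exact Or.inl ⟨h, rfl⟩
  · exact ⟨h, Or.inl rfl⟩

theorem prodAdj_succ (x : Pt) (k : ℕ) : prodAdj j (cAdj j) (x, k) (x, k + 1) := by
  unfold prodAdj
  split
  · exact Or.inr ⟨rfl, Or.inr (Or.inl rfl)⟩
  · exact ⟨cAdj_refl j x, Or.inr (Or.inl rfl)⟩

theorem IsDeformation.bounds {A : Set Pt} {M : ℕ} {S : Pt → ℕ → Pt} {Φ : Pt → Pt}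
    (h : IsDeformation j A M S Φ) {x : Pt} (hx : x ∈ A) :
    x ∈ Set.Icc (Φ x - ((M : ℤ), (M : ℤ))) (Φ x + ((M : ℤ), (M : ℤ))) := by
  obtain ⟨h0, hM, -, hadj⟩ := h
  have hall (k : ℕ) (hk : k ≤ M) : (S x k).1 ≤ (Φ x).1 + k ∧ (Φ x).1 ≤ (S x k).1 + k ∧
      (S x k).2 ≤ (Φ x).2 + k ∧ (Φ x).2 ≤ (S x k).2 + k := by
    induction k with
    | zero => simp [h0 x hx]
    | succ k ih =>
      have := cAdj_bounds (hadj x hx x hx k (k + 1) (by omega) hk (prodAdj_succ x k))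
      have := ih (by omega)
      push_cast
      omega
  have := hall M le_rfl
  rw [hM x hx] at this
  simp only [Set.mem_Icc, Prod.le_def, Prod.fst_sub, Prod.snd_sub, Prod.fst_add, Prod.snd_add]
  omega

theorem IsDeformation.mem_infPart {X : Set Pt} {M : ℕ} {S : Pt → ℕ → Pt} {Φ : Pt → Pt}
    (h : IsDeformation j Xᶜ M S Φ) {x : Pt} (hx : x ∈ InfPart j X) {k : ℕ} (hk : k ≤ M) :
    S x k ∈ InfPart j X := by
  have hall (n : ℕ) (hn : n ≤ M) : S x (M - n) ∈ InfPart j X := by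
    induction n with
    | zero => simpa only [Nat.sub_zero, h.2.1 x hx.1] using hx
    | succ n ih =>
      refine mem_infPart_of_cAdj (ih (by omega)) (h.2.2.1 x hx.1 _) (cAdj_symm ?_)
      have := prodAdj_succ (j := j) x (M - (n + 1))
      rw [show M - (n + 1) + 1 = M - n by omega] at this
      exact h.2.2.2 x hx.1 x hx.1 _ _ (by omega) (by omega) this
  simpa only [Nat.sub_sub_self hk] using hall (M - k) (by omega)

theorem IsDeformation.mapsTo_infPart {X Y : Set Pt} {M : ℕ} {S : Pt → ℕ → Pt} {F G : Pt → Pt}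
    (h : IsDeformation j Xᶜ M S (G ∘ F)) (hF : Set.MapsTo F Xᶜ Yᶜ)
    (hadj : ∀ x ∈ Xᶜ, ∀ y ∈ Xᶜ, cAdj j x y → cAdj j (F x) (F y)) :
    Set.MapsTo F (InfPart j X) (InfPart j Y) := by
  intro x hx
  refine ⟨hF hx.1, fun hfin => hx.2 ?_⟩
  refine ((hfin.image G).biUnion fun w _ =>
    Set.finite_Icc (w - ((M : ℤ), (M : ℤ))) (w + ((M : ℤ), (M : ℤ)))).subset fun y hy => ?_
  exact Set.mem_biUnion (Set.mem_image_of_mem G (ChainIn.map hF hadj hy))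
    (h.bounds (ChainIn.mem_right hy))

open Classical in
/-- The extension by the identity of a map between subsets of the plane. -/
noncomputable def planeExtension {A B : Set Pt} (f : A → B) (p : Pt) : Pt :=
  if h : p ∈ A then f ⟨p, h⟩ else p

theorem planeExtension_of_mem {A B : Set Pt} (f : A → B) {p : Pt} (h : p ∈ A) :
    planeExtension f p = f ⟨p, h⟩ :=
  dif_pos h

theorem planeExtension_mapsTo {A B : Set Pt} (f : A → B) :
    Set.MapsTo (planeExtension f) A B := fun p hp => by
  rw [planeExtension_of_mem f hp]
  exact (f ⟨p, hp⟩).2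

theorem DigCont.planeExtension {A B : Set Pt} {f : A → B}
    (hf : DigCont (subAdj j A) (subAdj j B) f) :
    ∀ x ∈ A, ∀ y ∈ A, cAdj j x y → cAdj j (planeExtension f x) (planeExtension f y) :=
  fun x hx y hy h => by
    rw [planeExtension_of_mem f hx, planeExtension_of_mem f hy]
    exact hf ⟨x, hx⟩ ⟨y, hy⟩ h

theorem Homotopic.exists_isDeformation {A B : Set Pt} {f : A → B} {g : B → A}
    (h : Homotopic j (subAdj j A) (subAdj j A) (g ∘ f) id) :
    ∃ M S, IsDeformation j A M S (planeExtension g ∘ planeExtension f) := by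
  obtain ⟨M, H, h0, hM, hadj⟩ := h
  refine ⟨M, fun x k => planeExtension (fun a => H a k) x, fun x hx => ?_, fun x hx => ?_,
    fun x hx k => planeExtension_mapsTo _ hx, fun x hx y hy s t hs ht hst => ?_⟩
  · simp only [Function.comp_apply, planeExtension_of_mem _ hx, h0]
    rw [planeExtension_of_mem g (f ⟨x, hx⟩).2]
  · simp [planeExtension_of_mem _ hx, hM]
  · dsimp only
    rw [planeExtension_of_mem _ hx, planeExtension_of_mem _ hy]
    refine hadj ⟨x, hx⟩ ⟨y, hy⟩ s t hs ht ?_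
    simpa only [prodAdj, subAdj, Subtype.mk.injEq] using hst

theorem IsDeformation.freelyContractibleIn {X : Set Pt} {M m : ℕ} {S : Pt → ℕ → Pt}
    {Φ : Pt → Pt} {γ : ℕ → Pt} (h : IsDeformation j Xᶜ M S Φ)
    (hγ : LoopIn j (InfPart j X) m γ) (hΦ : FreelyContractibleIn j (InfPart j X) m (Φ ∘ γ)) :
    FreelyContractibleIn j (InfPart j X) m γ := by
  have hX {t : ℕ} (ht : t ≤ m) : γ t ∈ Xᶜ := (hγ.2.1 t ht).1
  have hloop (k : ℕ) (hk : k ≤ M) : LoopIn j (InfPart j X) m fun t => S (γ t) k :=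
    ⟨congrArg (S · k) hγ.1, fun t ht => h.mem_infPart (hγ.2.1 t ht) hk, fun t ht =>
      h.2.2.2 _ (hX ht.le) _ (hX ht) k k hk hk (prodAdj_of_cAdj (hγ.2.2 t ht) k)⟩
  have hstep (k : ℕ) (hk : k < M) :
      LoopStep j m (fun t => S (γ t) (k + 1)) (fun t => S (γ t) k) := by
    refine fun s t hs ht hst => cAdj_symm ?_
    refine h.2.2.2 _ (hX ht) _ (hX hs) k (k + 1) hk.le hk ?_
    rcases hst with rfl | ⟨hj, hst⟩
    · exact prodAdj_succ _ k
    · rw [prodAdj, if_neg hj]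
      exact ⟨hγ.cAdj_of_natAdj ht hs (natAdj_symm hst), Or.inr (Or.inl rfl)⟩
  have hall (k : ℕ) (hk : k ≤ M) :
      FreelyContractibleIn j (InfPart j X) m fun t => S (γ t) k := by
    induction k with
    | zero =>
      refine hΦ.of_step (hloop 0 hk) fun s t hs ht hst => ?_
      rw [Function.comp, ← h.1 _ (hX ht)]
      exact (hloop 0 hk).cAdj_of_natAdj hs ht hst.natAdj
    | succ k ih => exact (ih (by omega)).of_step (hloop _ hk) (hstep k hk)
  refine (hall M le_rfl).of_step hγ fun s t hs ht hst => ?_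
  rw [h.2.1 _ (hX ht)]
  exact hγ.cAdj_of_natAdj hs ht hst.natAdj

/-- The lengths of the non-contractible loops in the infinite part of the complement of `X`. -/
def essentialLengths (j : ℕ) (X : Set Pt) : Set ℕ :=
  {m | ∃ γ, LoopIn j (InfPart j X) m γ ∧ ¬ LoopContractibleIn j (InfPart j X) m γ}

theorem HtpyEquiv.symm {i : ℕ} {α β : Type} {κ : α → α → Prop} {δ : β → β → Prop}
    (h : HtpyEquiv i κ δ) : HtpyEquiv i δ κ := by
  obtain ⟨f, g, hf, hg, hgf, hfg⟩ := h
  exact ⟨g, f, hg, hf, hfg, hgf⟩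

theorem HtpyEquiv.sInf_mem_essentialLengths {X Y : Set Pt}
    (h : HtpyEquiv j (subAdj j Xᶜ) (subAdj j Yᶜ)) (hX : (essentialLengths j X).Nonempty) :
    sInf (essentialLengths j X) ∈ essentialLengths j Y := by
  obtain ⟨f, g, hf, hg, hgf, hfg⟩ := h
  obtain ⟨M, S, hS⟩ := hgf.exists_isDeformation
  obtain ⟨N, T, hT⟩ := hfg.exists_isDeformation
  have hF := hS.mapsTo_infPart (planeExtension_mapsTo f) hf.planeExtension
  have hG := hT.mapsTo_infPart (planeExtension_mapsTo g) hg.planeExtension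
  have hFadj : ∀ x ∈ InfPart j X, ∀ y ∈ InfPart j X, cAdj j x y →
      cAdj j (planeExtension f x) (planeExtension f y) :=
    fun x hx y hy => hf.planeExtension x hx.1 y hy.1
  have hGadj : ∀ x ∈ InfPart j Y, ∀ y ∈ InfPart j Y, cAdj j x y →
      cAdj j (planeExtension g x) (planeExtension g y) :=
    fun x hx y hy => hg.planeExtension x hx.1 y hy.1
  obtain ⟨γ, hγ, hnc⟩ := Nat.sInf_mem hX
  refine ⟨planeExtension f ∘ γ, hγ.map hF hFadj, fun hc => hnc ?_⟩
  refine hγ.contractible_of_freely (fun m' hm' β hβ => ?_)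
    (hS.freelyContractibleIn hγ (hc.map hG hGadj).freely)
  by_contra hβnc
  exact Nat.notMem_of_lt_sInf hm' ⟨β, hβ, hβnc⟩

theorem outerPerim_eq (j : ℕ) (X : Set Pt) [Decidable (essentialLengths j X).Nonempty] :
    outerPerim j X =
      if (essentialLengths j X).Nonempty then sInf (essentialLengths j X) else 1 := by
  unfold outerPerim
  congr

end Invariance

/-- the outer perimeter is a homotopy-type invariant of digital pictures. -/
theorem stmt3 (i j : ℕ) (hij : (i = 1 ∧ j = 2) ∨ (i = 2 ∧ j = 1))
    (X Y : Set Pt) (hX : X.Finite) (hY : Y.Finite)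
    (h : PicHtpyEquiv i j X Y) :
    outerPerim j X = outerPerim j Y := by
  classical
  have hXY := h.2
  have hiff : (essentialLengths j X).Nonempty ↔ (essentialLengths j Y).Nonempty :=
    ⟨fun hne => ⟨_, hXY.sInf_mem_essentialLengths hne⟩,
      fun hne => ⟨_, hXY.symm.sInf_mem_essentialLengths hne⟩⟩
  rw [outerPerim_eq, outerPerim_eq]
  by_cases hne : (essentialLengths j X).Nonempty
  · rw [if_pos hne, if_pos (hiff.1 hne)]
    exact le_antisymm (Nat.sInf_le (hXY.symm.sInf_mem_essentialLengths (hiff.1 hne)))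
      (Nat.sInf_le (hXY.sInf_mem_essentialLengths hne))
  · rw [if_neg hne, if_neg (hne ∘ hiff.2)]
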